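/- Consider the discrete eikonal setting: Ω := (ℝ/ℤ)^d, Ω_n := {0,1/n,…,(n−1)/n}^d, 𝓜 : Ω → S_d^+ continuous, and for each z ∈ Ω an 𝓜(z)-reduced mesh 𝒯(z). Assume (Limited extension): there is V_0 such that every vertex v of every mesh 𝒯(z), z ∈ Ω, satisfies ‖v‖ ≤ V_0; and (Consistency): there is r_0 > 0 such that for each z ∈ Ω there exists a basis (u_1,…,u_d) of ℤ^d with u_1,…,u_d,−u_1,…,−u_d vertices of 𝒯(z+w) for all w with ‖w‖ ≤ r_0. For each n ≥ 2, let d_n : Ω_n → [0,∞] solve the discrete system. Let U : Ω → ℝ_+ be a viscosity solution of the anisotropic eikonal equation ‖∇U(z)‖_{𝓜(z)⁻¹} = 1 on Ω \ {0} with U(0) = 0, and assume that every such viscosity solution equals U (uniqueness). Then max_{z ∈ Ω_n} |U(z) − d_n(z)| → 0 as n → ∞. -/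

import Mathlib

open Matrix
open scoped BigOperators ENNReal Classical

noncomputable section

/-- Euclidean norm of a vector of `ℝ^d`. -/
def euclNorm {d : ℕ} (u : Fin d → ℝ) : ℝ := Real.sqrt (u ⬝ᵥ u)

/-- The norm `‖u‖_M := √(uᵀ M u)` associated to a matrix `M`. -/
def normM {d : ℕ} (M : Matrix (Fin d) (Fin d) ℝ) (u : Fin d → ℝ) : ℝ :=
  Real.sqrt (u ⬝ᵥ M.mulVec u)

/-- Operator norm of a matrix, with respect to the euclidean norm. -/
def opNorm {d : ℕ} (M : Matrix (Fin d) (Fin d) ℝ) : ℝ :=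
  sSup {r : ℝ | ∃ u : Fin d → ℝ, euclNorm u = 1 ∧ r = euclNorm (M.mulVec u)}

/-- Anisotropy ratio `κ(M) := max ‖u‖_M/‖v‖_M` over euclidean-unit vectors `u, v`. -/
def kappa {d : ℕ} (M : Matrix (Fin d) (Fin d) ℝ) : ℝ :=
  sSup {r : ℝ | ∃ u v : Fin d → ℝ,
    euclNorm u = 1 ∧ euclNorm v = 1 ∧ r = normM M u / normM M v}

/-- `z` has integer coordinates, i.e. `z ∈ ℤ^d`. -/
def IsIntVec {d : ℕ} (z : Fin d → ℝ) : Prop := ∀ i, ∃ m : ℤ, z i = (m : ℝ)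

/-- `z` belongs to the sub-lattice `u_0 ℤ + ⋯ + u_{k-1} ℤ` generated by the
first `k` vectors of the family `u`. -/
def InLatticeSpan {d : ℕ} (u : Fin d → Fin d → ℝ) (k : ℕ) (z : Fin d → ℝ) : Prop :=
  ∃ c : Fin d → ℤ, (∀ i : Fin d, ¬ ((i : ℕ) < k) → c i = 0) ∧ z = ∑ i, (c i : ℝ) • u i

/-- `u` is an `M`-reduced basis of `ℤ^d`: a basis of the lattice `ℤ^d`
(integer entries, determinant `±1`) such that each `u k` minimizes `‖·‖_M`
among integer vectors outside the sub-lattice spanned by `u 0, …, u (k-1)`. -/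
def IsReducedBasis {d : ℕ} (M : Matrix (Fin d) (Fin d) ℝ) (u : Fin d → Fin d → ℝ) : Prop :=
  (∀ i, IsIntVec (u i)) ∧ |(Matrix.of u).det| = 1 ∧
  ∀ k : Fin d, ∀ z : Fin d → ℝ, IsIntVec z → ¬ InLatticeSpan u (k : ℕ) z →
    normM M (u k) ≤ normM M z

/-- A simplex of `ℝ^d`, described by its vertex set: `d+1` affinely independent points. -/
def IsSimplex (d : ℕ) (V : Finset (Fin d → ℝ)) : Prop :=
  V.card = d + 1 ∧ AffineIndependent ℝ (fun v : V => (v : Fin d → ℝ))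

/-- A (conforming) mesh: a finite collection of simplices such that the intersection
of any two of them is the convex hull of their common vertices. -/
def IsMesh (d : ℕ) (𝒯 : Finset (Finset (Fin d → ℝ))) : Prop :=
  (∀ V ∈ 𝒯, IsSimplex d V) ∧
  ∀ S ∈ 𝒯, ∀ T ∈ 𝒯,
    (convexHull ℝ (S : Set (Fin d → ℝ))) ∩ (convexHull ℝ (T : Set (Fin d → ℝ)))
      = convexHull ℝ ((S ∩ T : Finset (Fin d → ℝ)) : Set (Fin d → ℝ))

/-- An `M`-reduced mesh. -/
def IsReducedMesh {d : ℕ} (M : Matrix (Fin d) (Fin d) ℝ)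
    (𝒯 : Finset (Finset (Fin d → ℝ))) : Prop :=
  IsMesh d 𝒯 ∧
  (⋃ V ∈ 𝒯, convexHull ℝ (V : Set (Fin d → ℝ))) ∈ nhds (0 : Fin d → ℝ) ∧
  (∀ V ∈ 𝒯, ∀ v ∈ V, IsIntVec v) ∧
  (∀ V ∈ 𝒯, MeasureTheory.volume (convexHull ℝ (V : Set (Fin d → ℝ)))
      = ENNReal.ofReal (1 / (Nat.factorial d))) ∧
  (∀ V ∈ 𝒯, (0 : Fin d → ℝ) ∈ V) ∧
  (∀ V ∈ 𝒯, ∀ v ∈ V, ∀ w ∈ V, v ≠ 0 → w ≠ 0 → 0 ≤ v ⬝ᵥ M.mulVec w)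

/-- `z` is a vertex of the mesh `𝒯`. -/
def IsMeshVertex {d : ℕ} (𝒯 : Finset (Finset (Fin d → ℝ))) (z : Fin d → ℝ) : Prop :=
  ∃ V ∈ 𝒯, z ∈ V

/-- The multiplicative distance `d_×(M,N) := sup_{u ≠ 0} |ln ‖u‖_M − ln ‖u‖_N|`. -/
def dTimes {d : ℕ} (M N : Matrix (Fin d) (Fin d) ℝ) : ℝ :=
  sSup {r : ℝ | ∃ u : Fin d → ℝ, u ≠ 0 ∧ r = |Real.log (normM M u) - Real.log (normM N u)|}

/-- The periodic unit box `Ω = (ℝ/ℤ)^d`. -/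
abbrev Torus (d : ℕ) : Type := Fin d → AddCircle (1 : ℝ)

/-- Canonical projection `ℝ^d → (ℝ/ℤ)^d`. -/
def toTorus {d : ℕ} (x : Fin d → ℝ) : Torus d := fun i => (x i : AddCircle (1 : ℝ))

/-- The grid `Ω_n = {0, 1/n, …, (n-1)/n}^d ⊂ Ω`. -/
def IsGridPoint {d : ℕ} (n : ℕ) (z : Torus d) : Prop :=
  ∃ k : Fin d → ℤ, ∀ i, z i = (((k i : ℝ) / (n : ℝ) : ℝ) : AddCircle (1 : ℝ))

/-- The quotient (periodic) distance on the torus. -/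
def dPer {d : ℕ} (z x : Torus d) : ℝ :=
  sInf {r : ℝ | ∃ Z X : Fin d → ℝ, toTorus Z = z ∧ toTorus X = x ∧ r = euclNorm (Z - X)}

/-- The Hopf–Lax update operator associated to the matrix `M`, the stencil (mesh) `𝒯`,
and the grid scale `1/n`: minimum over simplices `T ∈ 𝒯`, and over barycentric
coefficients `α ≥ 0` supported on the nonzero vertices of `T` with total mass 1, of
`‖∑ α_v v/n‖_M + ∑ α_v u(z + v/n)` (with the convention `0·∞ = 0`). -/
def hopfLax {d : ℕ} (M : Matrix (Fin d) (Fin d) ℝ) (𝒯 : Finset (Finset (Fin d → ℝ)))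
    (n : ℕ) (u : Torus d → ℝ≥0∞) (z : Torus d) : ℝ≥0∞ :=
  ⨅ (T : Finset (Fin d → ℝ)) (_ : T ∈ 𝒯) (α : (Fin d → ℝ) → ℝ)
    (_ : ∀ w, 0 ≤ α w) (_ : α 0 = 0) (_ : ∑ w ∈ T, α w = 1),
    ENNReal.ofReal (normM M ((n : ℝ)⁻¹ • ∑ w ∈ T, α w • w)) +
      ∑ w ∈ T, ENNReal.ofReal (α w) * u (z + toTorus ((n : ℝ)⁻¹ • w))

/-- `u` solves the discrete fixed point system: `u(0) = 0` and
`u(z) = Λ_n(u,z)` at every other grid point `z`. -/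
def SolvesDiscrete {d : ℕ} (𝓜 : Torus d → Matrix (Fin d) (Fin d) ℝ)
    (𝒯 : Torus d → Finset (Finset (Fin d → ℝ))) (n : ℕ) (u : Torus d → ℝ≥0∞) : Prop :=
  u 0 = 0 ∧ ∀ z : Torus d, IsGridPoint n z → z ≠ 0 → u z = hopfLax (𝓜 z) (𝒯 z) n u z


/-- A viscosity solution of the anisotropic eikonal equation
`‖∇U(z)‖_{𝓜(z)⁻¹} = 1` on `Ω \ {0}`, `U(0) = 0`, on the torus `Ω = (ℝ/ℤ)^d`,
tested against `C¹` periodic test functions. -/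
def IsViscositySol {d : ℕ} (𝓜 : Torus d → Matrix (Fin d) (Fin d) ℝ)
    (U : Torus d → ℝ) : Prop :=
  Continuous U ∧ (∀ z, 0 ≤ U z) ∧ U 0 = 0 ∧
  ∀ Φ : (Fin d → ℝ) → ℝ, ContDiff ℝ 1 Φ →
    (∀ x : Fin d → ℝ, ∀ m : Fin d → ℤ, Φ (x + fun i => (m i : ℝ)) = Φ x) →
    ∀ Z : Fin d → ℝ, toTorus Z ≠ 0 →
      ((∀ x : Fin d → ℝ, toTorus x ≠ toTorus Z →
          U (toTorus x) - Φ x < U (toTorus Z) - Φ Z) →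
        normM (𝓜 (toTorus Z))⁻¹ (fun i => fderiv ℝ Φ Z (Pi.single i 1)) ≤ 1) ∧
      ((∀ x : Fin d → ℝ, toTorus x ≠ toTorus Z →
          U (toTorus Z) - Φ Z < U (toTorus x) - Φ x) →
        1 ≤ normM (𝓜 (toTorus Z))⁻¹ (fun i => fderiv ℝ Φ Z (Pi.single i 1)))

/-! ### Torus lemmas -/

lemma toTorus_add {d : ℕ} (x y : Fin d → ℝ) : toTorus (x + y) = toTorus x + toTorus y := by
  funext i; simp [toTorus]

lemma toTorus_zero {d : ℕ} : toTorus (0 : Fin d → ℝ) = 0 := by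
  funext i; simp [toTorus]

lemma toTorus_neg {d : ℕ} (x : Fin d → ℝ) : toTorus (-x) = -toTorus x := by
  funext i; simp [toTorus]

lemma toTorus_sum_zsmul {d : ℕ} (c : Fin d → ℤ) (u : Fin d → Fin d → ℝ) :
    ∑ i, c i • toTorus (u i) = toTorus (∑ i, (c i : ℝ) • u i) := by
  funext j
  simp only [toTorus, Finset.sum_apply, Pi.smul_apply, smul_eq_mul]
  have : ∀ s : Finset (Fin d), ((∑ i ∈ s, (c i : ℝ) * u i j : ℝ) : AddCircle (1:ℝ))
      = ∑ i ∈ s, c i • ((u i j : ℝ) : AddCircle (1:ℝ)) := by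
    intro s
    induction s using Finset.induction_on with
    | empty => simp
    | insert a s ha ih =>
      rw [Finset.sum_insert ha, Finset.sum_insert ha, AddCircle.coe_add, ih, ← zsmul_eq_mul,
        AddCircle.coe_zsmul]
  rw [this]

lemma continuous_toTorus {d : ℕ} : Continuous (toTorus : (Fin d → ℝ) → Torus d) := by
  refine continuous_pi fun i => ?_
  exact (AddCircle.continuous_mk' (1:ℝ)).comp (continuous_apply i)

lemma exists_lift {d : ℕ} (w : Torus d) : ∃ r : Fin d → ℝ, toTorus r = w ∧ ‖r‖ ≤ ‖w‖ := by
  have h : ∀ i, ∃ x : ℝ, (x : AddCircle (1:ℝ)) = w i ∧ |x| ≤ ‖w i‖ := by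
    intro i
    obtain ⟨x, hx⟩ := QuotientAddGroup.mk_surjective (w i)
    refine ⟨x - round x, ?_, ?_⟩
    · rw [← hx]
      have : ((round x : ℝ) : AddCircle (1:ℝ)) = 0 := by
        rw [AddCircle.coe_eq_zero_iff]; exact ⟨round x, by simp⟩
      rw [AddCircle.coe_sub, this, sub_zero]
    · rw [← hx]
      have := AddCircle.norm_eq (p := (1:ℝ)) (x := x)
      simp at this
      exact this.ge
  choose r hr hr' using h
  refine ⟨r, funext hr, ?_⟩
  rw [pi_norm_le_iff_of_nonneg (norm_nonneg _)]
  intro i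
  exact (hr' i).trans (norm_le_pi_norm w i)

lemma grid_lift {d : ℕ} {n : ℕ} (hn : 0 < n) {w : Torus d} (hw : IsGridPoint n w) :
    ∃ k : Fin d → ℤ, w = toTorus ((n:ℝ)⁻¹ • fun i => (k i : ℝ)) ∧
      ∀ i, |(k i : ℝ)| ≤ n * ‖w‖ ∧ |(k i : ℝ)| ≤ n := by
  obtain ⟨k, hk⟩ := hw
  have hn' : (0:ℝ) < n := by exact_mod_cast hn
  have key : ∀ i, |((k i - n * round ((k i : ℝ) / n) : ℤ) : ℝ)|
      = n * |(k i : ℝ) / n - round ((k i : ℝ) / n)| := by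
    intro i
    rw [← abs_of_pos hn', ← abs_mul, abs_of_pos hn']
    congr 1
    push_cast
    field_simp
  refine ⟨fun i => k i - n * round ((k i : ℝ) / n), ?_, ?_⟩
  · funext i
    rw [hk i]
    simp only [toTorus, Pi.smul_apply, smul_eq_mul]
    have : ((round ((k i : ℝ) / n) : ℝ) : AddCircle (1:ℝ)) = 0 := by
      rw [AddCircle.coe_eq_zero_iff]; exact ⟨round ((k i : ℝ) / n), by simp⟩
    have e : (n:ℝ)⁻¹ * ((k i - n * round ((k i : ℝ) / n) : ℤ) : ℝ)
        = (k i : ℝ) / n - (round ((k i : ℝ) / n) : ℝ) := by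
      push_cast; field_simp
    rw [e, AddCircle.coe_sub, this, sub_zero]
  · intro i
    rw [key i]
    constructor
    · gcongr
      refine le_trans ?_ (norm_le_pi_norm w i)
      rw [hk i]
      have := AddCircle.norm_eq (p := (1:ℝ)) (x := (k i : ℝ) / n)
      simp at this
      exact this.ge
    · have := abs_sub_round ((k i : ℝ) / n)
      nlinarith

lemma isGridPoint_toTorus {d : ℕ} (n : ℕ) (v : Fin d → ℝ) (hv : IsIntVec v) :
    IsGridPoint n (toTorus ((n:ℝ)⁻¹ • v)) := by
  choose k hk using hv
  refine ⟨k, fun i => ?_⟩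
  simp only [toTorus, Pi.smul_apply, smul_eq_mul, hk i]
  congr 1
  field_simp

lemma IsGridPoint.add {d : ℕ} {n : ℕ} {z w : Torus d} (hz : IsGridPoint n z)
    (hw : IsGridPoint n w) : IsGridPoint n (z + w) := by
  obtain ⟨k, hk⟩ := hz
  obtain ⟨l, hl⟩ := hw
  refine ⟨k + l, fun i => ?_⟩
  rw [Pi.add_apply, hk, hl, ← AddCircle.coe_add]
  congr 1
  simp [add_div]

lemma IsGridPoint.neg {d : ℕ} {n : ℕ} {z : Torus d} (hz : IsGridPoint n z) :
    IsGridPoint n (-z) := by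
  obtain ⟨k, hk⟩ := hz
  refine ⟨-k, fun i => ?_⟩
  rw [Pi.neg_apply, hk, ← AddCircle.coe_neg]
  congr 1
  simp [neg_div]

lemma IsGridPoint.sub {d : ℕ} {n : ℕ} {z w : Torus d} (hz : IsGridPoint n z)
    (hw : IsGridPoint n w) : IsGridPoint n (z - w) := by
  rw [sub_eq_add_neg]; exact hz.add hw.neg

lemma isGridPoint_zero {d : ℕ} (n : ℕ) : IsGridPoint n (0 : Torus d) :=
  ⟨0, fun i => by simp⟩

lemma IsGridPoint.zsmul {d : ℕ} {n : ℕ} {z : Torus d} (hz : IsGridPoint n z) (c : ℤ) :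
    IsGridPoint n (c • z) := by
  induction c using Int.induction_on with
  | zero => simpa using isGridPoint_zero n
  | succ i ih => rw [add_smul, one_smul]; exact ih.add hz
  | pred i ih => rw [sub_smul, one_smul]; exact ih.sub hz

lemma isGridPoint_sum {d : ℕ} {n : ℕ} (f : Fin d → Torus d) (hf : ∀ i, IsGridPoint n (f i)) :
    IsGridPoint n (∑ i, f i) :=
  Finset.sum_induction _ _ (fun _ _ h h' => h.add h') (isGridPoint_zero n) (fun i _ => hf i)

lemma grid_finite {d : ℕ} {n : ℕ} (hn : 0 < n) : {z : Torus d | IsGridPoint n z}.Finite := by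
  refine ((Set.finite_Icc (fun _ => -(n:ℤ) : Fin d → ℤ) (fun _ => (n:ℤ))).image
    (fun k => toTorus ((n:ℝ)⁻¹ • fun i => (k i : ℝ)))).subset ?_
  intro w hw
  obtain ⟨k, hk, hk'⟩ := grid_lift hn hw
  refine ⟨k, ⟨fun i => ?_, fun i => ?_⟩, hk.symm⟩
  · have := (abs_le.1 (hk' i).2).1
    exact_mod_cast this
  · have := (abs_le.1 (hk' i).2).2
    exact_mod_cast this

/-! ### Walks -/

lemma walk {A : Type*} [AddCommGroup A] {d : ℕ} (h : A → ℝ≥0∞) (E : Fin d → A) (z : A)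
    (K : ℝ≥0∞) (m : ℕ)
    (hstep : ∀ c : Fin d → ℤ, ∑ i, (c i).natAbs < m → ∀ i,
      h (z + ∑ j, c j • E j) ≤ K + h (z + ∑ j, c j • E j + E i) ∧
      h (z + ∑ j, c j • E j) ≤ K + h (z + ∑ j, c j • E j - E i)) :
    ∀ l : ℕ, l ≤ m → ∀ c : Fin d → ℤ, ∑ i, (c i).natAbs = l →
      h z ≤ l * K + h (z + ∑ j, c j • E j) := by
  intro l
  induction l with
  | zero =>
    intro _ c hc
    have : ∀ i, c i = 0 := by simpa using hc
    simp [this]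
  | succ l ih =>
    intro hl c hc
    obtain ⟨i, hi⟩ : ∃ i, c i ≠ 0 := by
      by_contra! hcon
      simp [hcon] at hc
    have main : ∀ s : ℤ, (s = 1 ∨ s = -1) → (c i - s).natAbs + 1 = (c i).natAbs →
        h z ≤ (l + 1 : ℕ) * K + h (z + ∑ j, c j • E j) := by
      intro s hs hsc
      set c' : Fin d → ℤ := c - Pi.single i s with hc'
      have h1 : ∑ j, (c' j).natAbs + 1 = ∑ j, (c j).natAbs := by
        rw [← Finset.add_sum_erase _ _ (Finset.mem_univ i),
          ← Finset.add_sum_erase _ (fun j => (c j).natAbs) (Finset.mem_univ i)]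
        have : ∑ j ∈ Finset.univ.erase i, (c' j).natAbs
            = ∑ j ∈ Finset.univ.erase i, (c j).natAbs := by
          refine Finset.sum_congr rfl fun j hj => ?_
          simp [hc', Finset.ne_of_mem_erase hj]
        rw [this]
        have : c' i = c i - s := by simp [hc']
        rw [this]
        omega
      have h2 : ∑ j, c j • E j = ∑ j, c' j • E j + s • E i := by
        have : ∀ j, c j • E j = c' j • E j + (Pi.single i s : Fin d → ℤ) j • E j := by
          intro j
          rw [← add_smul]; simp [hc']
        rw [Finset.sum_congr rfl fun j _ => this j, Finset.sum_add_distrib]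
        congr 1
        rw [Finset.sum_eq_single i]
        · simp
        · intro j _ hj; simp [hj]
        · simp
      have h3 := ih (by omega) c' (by omega)
      have h4 := hstep c' (by omega) i
      rw [h2]
      have h5 : h (z + ∑ j, c' j • E j) ≤ K + h (z + (∑ j, c' j • E j + s • E i)) := by
        rcases hs with rfl | rfl
        · rw [one_smul, ← add_assoc]; exact h4.1
        · rw [neg_smul, one_smul, ← add_assoc, ← sub_eq_add_neg]; exact h4.2
      calc h z ≤ l * K + h (z + ∑ j, c' j • E j) := h3
        _ ≤ l * K + (K + h (z + (∑ j, c' j • E j + s • E i))) := by gcongr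
        _ = _ := by push_cast; ring
    rcases lt_or_gt_of_ne hi with h0 | h0
    · exact main (-1) (Or.inr rfl) (by omega)
    · exact main 1 (Or.inl rfl) (by omega)

/-! ### Norm lemmas -/

lemma euclNorm_eq {d : ℕ} (u : Fin d → ℝ) : euclNorm u = ‖WithLp.toLp 2 u‖ := by
  rw [EuclideanSpace.norm_eq, euclNorm]
  congr 1
  simp [dotProduct, sq]

lemma euclNorm_add_le {d : ℕ} (u v : Fin d → ℝ) :
    euclNorm (u + v) ≤ euclNorm u + euclNorm v := by
  simp only [euclNorm_eq]; exact norm_add_le _ _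

lemma euclNorm_smul {d : ℕ} (c : ℝ) (u : Fin d → ℝ) :
    euclNorm (c • u) = |c| * euclNorm u := by
  simp only [euclNorm_eq, WithLp.toLp_smul, norm_smul, Real.norm_eq_abs]

lemma euclNorm_sum_le {d : ℕ} {ι : Type*} (s : Finset ι) (f : ι → Fin d → ℝ) :
    euclNorm (∑ i ∈ s, f i) ≤ ∑ i ∈ s, euclNorm (f i) := by
  simp only [euclNorm_eq, WithLp.toLp_sum]; exact norm_sum_le _ _

lemma norm_le_euclNorm {d : ℕ} (u : Fin d → ℝ) : ‖u‖ ≤ euclNorm u := by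
  rw [euclNorm_eq, pi_norm_le_iff_of_nonneg (norm_nonneg _)]
  intro i
  exact PiLp.norm_apply_le (WithLp.toLp 2 u) i

lemma normM_smul {d : ℕ} (M : Matrix (Fin d) (Fin d) ℝ) (c : ℝ) (u : Fin d → ℝ) :
    normM M (c • u) = |c| * normM M u := by
  rw [normM, normM, Matrix.mulVec_smul, dotProduct_smul, smul_dotProduct, smul_eq_mul,
    smul_eq_mul, ← mul_assoc, Real.sqrt_mul (mul_self_nonneg c), Real.sqrt_mul_self_eq_abs]

lemma normM_nonneg {d : ℕ} (M : Matrix (Fin d) (Fin d) ℝ) (u : Fin d → ℝ) : 0 ≤ normM M u :=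
  Real.sqrt_nonneg _

lemma posDef_pos {d : ℕ} {M : Matrix (Fin d) (Fin d) ℝ} (hM : M.PosDef) {u : Fin d → ℝ}
    (hu : u ≠ 0) : 0 < u ⬝ᵥ M.mulVec u := by
  simpa using hM.dotProduct_mulVec_pos hu

lemma posDef_nonneg {d : ℕ} {M : Matrix (Fin d) (Fin d) ℝ} (hM : M.PosDef) (u : Fin d → ℝ) :
    0 ≤ u ⬝ᵥ M.mulVec u := by
  by_cases h : u = 0
  · simp [h]
  · exact (posDef_pos hM h).le

lemma normM_sq {d : ℕ} {M : Matrix (Fin d) (Fin d) ℝ} (hM : M.PosDef) (u : Fin d → ℝ) :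
    normM M u ^ 2 = u ⬝ᵥ M.mulVec u := Real.sq_sqrt (posDef_nonneg hM u)

lemma continuous_normM {d : ℕ} (𝓜 : Torus d → Matrix (Fin d) (Fin d) ℝ) (hcont : Continuous 𝓜) :
    Continuous (fun p : Torus d × (Fin d → ℝ) => normM (𝓜 p.1) p.2) := by
  unfold normM
  refine Real.continuous_sqrt.comp ?_
  exact Continuous.dotProduct continuous_snd
    (Continuous.matrix_mulVec (hcont.comp continuous_fst) continuous_snd)

lemma acute {d : ℕ} {M : Matrix (Fin d) (Fin d) ℝ}
    {𝒯 : Finset (Finset (Fin d → ℝ))} (h𝒯 : IsReducedMesh M 𝒯) {T : Finset (Fin d → ℝ)}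
    (hT : T ∈ 𝒯) (lam : ℝ) (hlam : ∀ v ∈ T, v ≠ 0 → lam ≤ normM M v)
    (β : (Fin d → ℝ) → ℝ) (hβ : ∀ w, 0 ≤ β w) (hβ0 : β 0 = 0) :
    lam * ∑ w ∈ T, β w ≤ (d + 1) * normM M (∑ w ∈ T, β w • w) := by
  obtain ⟨⟨hs, -⟩, -, -, -, -, hac⟩ := h𝒯
  have h1 : ∀ v ∈ T, lam * β v ≤ normM M (∑ w ∈ T, β w • w) := by
    intro v hv
    by_cases hv0 : v = 0
    · subst hv0; rw [hβ0, mul_zero]; exact normM_nonneg _ _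
    have h2 : normM M (β v • v) ≤ normM M (∑ w ∈ T, β w • w) := by
      unfold normM
      apply Real.sqrt_le_sqrt
      have hnn : ∀ a ∈ T, ∀ b ∈ T, 0 ≤ (β a • a) ⬝ᵥ M.mulVec (β b • b) := by
        intro a ha b hb
        by_cases ha0 : a = 0
        · simp [ha0]
        by_cases hb0 : b = 0
        · simp [hb0]
        rw [Matrix.mulVec_smul, dotProduct_smul, smul_dotProduct]
        have := hac T hT a ha b hb ha0 hb0
        have := hβ a
        have := hβ b
        simp only [smul_eq_mul]
        positivity
      rw [Matrix.mulVec_sum, sum_dotProduct]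
      simp_rw [dotProduct_sum]
      refine le_trans ?_ (Finset.single_le_sum (fun a ha => Finset.sum_nonneg (hnn a ha)) hv)
      exact Finset.single_le_sum (f := fun b => (β v • v) ⬝ᵥ M.mulVec (β b • b)) (hnn v hv) hv
    refine le_trans ?_ h2
    rw [normM_smul, abs_of_nonneg (hβ v), mul_comm]
    exact mul_le_mul_of_nonneg_left (hlam v hv hv0) (hβ v)
  rw [Finset.mul_sum]
  refine (Finset.sum_le_card_nsmul T _ _ h1).trans ?_
  rw [(hs T hT).1, nsmul_eq_mul]
  push_cast
  exact le_rfl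

lemma isIntVec_norm {d : ℕ} {v : Fin d → ℝ} (hv : IsIntVec v) (h0 : v ≠ 0) : 1 ≤ ‖v‖ := by
  obtain ⟨i, hi⟩ := Function.ne_iff.1 h0
  refine le_trans ?_ (norm_le_pi_norm v i)
  obtain ⟨m, hm⟩ := hv i
  have : m ≠ 0 := by rintro rfl; simp at hm; exact hi hm
  rw [hm, Real.norm_eq_abs]
  exact_mod_cast Int.one_le_abs this

lemma normM_bounds {d : ℕ} (𝓜 : Torus d → Matrix (Fin d) (Fin d) ℝ) (hcont : Continuous 𝓜)
    (hpd : ∀ z, (𝓜 z).PosDef) (V₀ : ℝ) :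
    (∃ lam : ℝ, 0 < lam ∧ ∀ z v, 1 ≤ ‖v‖ → ‖v‖ ≤ V₀ → lam ≤ normM (𝓜 z) v) ∧
    ∃ C : ℝ, 0 < C ∧ ∀ z v, ‖v‖ ≤ V₀ → normM (𝓜 z) v ≤ C := by
  have : Fact ((0:ℝ) < 1) := ⟨one_pos⟩
  have hc := continuous_normM 𝓜 hcont
  constructor
  · set S : Set (Torus d × (Fin d → ℝ)) := Set.univ ×ˢ {v | 1 ≤ ‖v‖ ∧ ‖v‖ ≤ V₀} with hS
    have hScomp : IsCompact S := by
      refine isCompact_univ.prod ?_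
      refine (isCompact_closedBall (0 : Fin d → ℝ) V₀).of_isClosed_subset ?_ ?_
      · exact (isClosed_le continuous_const continuous_norm).inter
          (isClosed_le continuous_norm continuous_const)
      · intro v hv; simpa using hv.2
    rcases S.eq_empty_or_nonempty with he | hne
    · refine ⟨1, one_pos, fun z v h1 h2 => ?_⟩
      have : (z, v) ∈ S := ⟨trivial, h1, h2⟩
      rw [he] at this; exact this.elim
    · obtain ⟨p, hp, hmin⟩ := hScomp.exists_isMinOn hne hc.continuousOn
      refine ⟨normM (𝓜 p.1) p.2, ?_, fun z v h1 h2 => hmin (show (z, v) ∈ S from ⟨trivial, h1, h2⟩)⟩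
      apply Real.sqrt_pos.2
      apply posDef_pos (hpd _)
      intro h
      have := hp.2.1
      rw [h, norm_zero] at this
      linarith
  · have hScomp : IsCompact ((Set.univ : Set (Torus d)) ×ˢ Metric.closedBall (0 : Fin d → ℝ) V₀) :=
      isCompact_univ.prod (isCompact_closedBall _ _)
    obtain ⟨C, hC⟩ := (hScomp.image hc).bddAbove
    refine ⟨max C 1, by positivity, fun z v h => le_max_of_le_left ?_⟩
    exact hC ⟨(z, v), ⟨trivial, by simpa using h⟩, rfl⟩

/-! ### Discrete estimates -/

lemma basis_coeff {d : ℕ} (V₀ : ℝ) : ∃ B : ℕ, ∀ u : Fin d → Fin d → ℝ,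
    (∀ i, IsIntVec (u i)) → |(Matrix.of u).det| = 1 → (∀ i, ‖u i‖ ≤ V₀) →
    ∀ j : Fin d, ∃ c : Fin d → ℤ, ∑ i, (c i).natAbs ≤ B ∧
      ∑ i, (c i : ℝ) • u i = Pi.single j 1 := by
  let q : (Fin d → Fin d → ℤ) → Fin d → Fin d → ℤ :=
    fun a j i => (Matrix.of a).det * (Matrix.of a).adjugate j i
  set K : ℤ := ⌈V₀⌉
  have hfin : (Set.Icc (fun _ _ => -K : Fin d → Fin d → ℤ) (fun _ _ => K)).Finite :=
    Set.finite_Icc _ _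
  obtain ⟨B, hB⟩ := (hfin.image fun a => ∑ j, ∑ i, (q a j i).natAbs).bddAbove
  refine ⟨B, fun u hu hdet hV j => ?_⟩
  choose a ha using hu
  have hua : Matrix.of u = (Matrix.of a).map (Int.castRingHom ℝ) := by
    ext i k; simp [ha i k]
  have hdet' : (Matrix.of a).det * (Matrix.of a).det = 1 := by
    rw [hua, ← RingHom.mapMatrix_apply, ← RingHom.map_det] at hdet
    simp only [eq_intCast] at hdet
    have : |(Matrix.of a).det| = 1 := by exact_mod_cast hdet
    rw [← abs_mul_abs_self, this, one_mul]
  have hmem : a ∈ Set.Icc (fun _ _ => -K : Fin d → Fin d → ℤ) (fun _ _ => K) := by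
    have : ∀ i k, |a i k| ≤ K := by
      intro i k
      have h1 : |(a i k : ℝ)| ≤ K := by
        rw [← ha i k]
        exact ((norm_le_pi_norm (u i) k).trans (hV i)).trans (Int.le_ceil _)
      exact_mod_cast h1
    exact ⟨fun i k => (abs_le.1 (this i k)).1, fun i k => (abs_le.1 (this i k)).2⟩
  refine ⟨q a j, ?_, ?_⟩
  · refine le_trans ?_ (hB ⟨a, hmem, rfl⟩)
    exact Finset.single_le_sum (f := fun j => ∑ i, (q a j i).natAbs) (fun _ _ => Nat.zero_le _)
      (Finset.mem_univ j)
  · funext k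
    have h1 := congrFun (congrFun (Matrix.adjugate_mul (Matrix.of a)) j) k
    simp only [Matrix.mul_apply, Matrix.smul_apply, Matrix.of_apply, smul_eq_mul] at h1
    have h2 : ∑ i, q a j i * a i k = (1 : Matrix (Fin d) (Fin d) ℤ) j k := by
      simp only [q, mul_assoc]
      rw [← Finset.mul_sum, h1, ← mul_assoc, hdet', one_mul]
    simp only [Finset.sum_apply, Pi.smul_apply, smul_eq_mul, ha]
    have h3 : ∑ i, (q a j i : ℝ) * (a i k : ℝ) = ((1 : Matrix (Fin d) (Fin d) ℤ) j k : ℝ) := by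
      rw [← h2]; push_cast; rfl
    rw [h3, Matrix.one_apply, Pi.single_apply]
    by_cases h : j = k
    · simp [h]
    · simp [h, Ne.symm h]

lemma discrete_le {d : ℕ} {𝓜 : Torus d → Matrix (Fin d) (Fin d) ℝ}
    {𝒯 : Torus d → Finset (Finset (Fin d → ℝ))} {n : ℕ} {u : Torus d → ℝ≥0∞}
    (hs : SolvesDiscrete 𝓜 𝒯 n u) {z : Torus d} (hz : IsGridPoint n z) (hz0 : z ≠ 0)
    {T : Finset (Fin d → ℝ)} (hT : T ∈ 𝒯 z) (α : (Fin d → ℝ) → ℝ) (hα : ∀ w, 0 ≤ α w)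
    (hα0 : α 0 = 0) (hα1 : ∑ w ∈ T, α w = 1) :
    u z ≤ ENNReal.ofReal (normM (𝓜 z) ((n : ℝ)⁻¹ • ∑ w ∈ T, α w • w)) +
      ∑ w ∈ T, ENNReal.ofReal (α w) * u (z + toTorus ((n : ℝ)⁻¹ • w)) := by
  rw [hs.2 z hz hz0, hopfLax]
  exact iInf_le_of_le T <| iInf_le_of_le hT <| iInf_le_of_le α <| iInf_le_of_le hα <|
    iInf_le_of_le hα0 <| iInf_le_of_le hα1 le_rfl

lemma discrete_vertex {d : ℕ} {𝓜 : Torus d → Matrix (Fin d) (Fin d) ℝ}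
    {𝒯 : Torus d → Finset (Finset (Fin d → ℝ))} {n : ℕ} {u : Torus d → ℝ≥0∞}
    (hs : SolvesDiscrete 𝓜 𝒯 n u) {z : Torus d} (hz : IsGridPoint n z)
    {v : Fin d → ℝ} (hv0 : v ≠ 0) (hv : IsMeshVertex (𝒯 z) v) :
    u z ≤ ENNReal.ofReal (normM (𝓜 z) ((n : ℝ)⁻¹ • v)) + u (z + toTorus ((n : ℝ)⁻¹ • v)) := by
  by_cases hz0 : z = 0
  · rw [hz0, hs.1]; exact zero_le
  obtain ⟨T, hT, hvT⟩ := hv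
  have h := discrete_le hs hz hz0 hT (fun w => if w = v then 1 else 0)
    (fun w => by positivity) (by simp [hv0.symm]) (by simp [hvT])
  have e : ∑ w ∈ T, (if w = v then (1:ℝ) else 0) • w = v := by
    simp [ite_smul, hvT]
  rw [e] at h
  refine h.trans ?_
  gcongr
  rw [Finset.sum_eq_single v]
  · simp
  · intro w _ hw; simp [hw]
  · intro h; exact (h hvT).elim

lemma discrete_lip {d : ℕ}
    (𝓜 : Torus d → Matrix (Fin d) (Fin d) ℝ) (hcont : Continuous 𝓜)
    (hpd : ∀ z, (𝓜 z).PosDef)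
    (𝒯 : Torus d → Finset (Finset (Fin d → ℝ)))
    (V₀ : ℝ)
    (hV₀ : ∀ z : Torus d, ∀ V ∈ 𝒯 z, ∀ v ∈ V, euclNorm v ≤ V₀)
    (r₀ : ℝ) (hr₀ : 0 < r₀)
    (hcons : ∀ z : Torus d, ∃ u : Fin d → Fin d → ℝ,
      (∀ i, IsIntVec (u i)) ∧ |(Matrix.of u).det| = 1 ∧
      ∀ w : Fin d → ℝ, euclNorm w ≤ r₀ →
        ∀ i : Fin d, IsMeshVertex (𝒯 (z + toTorus w)) (u i) ∧
          IsMeshVertex (𝒯 (z + toTorus w)) (-(u i)))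
    (g : ℕ → Torus d → ℝ≥0∞)
    (hg : ∀ n : ℕ, 2 ≤ n → SolvesDiscrete 𝓜 𝒯 n (g n)) :
    ∃ (L : ℝ) (N : ℕ), 0 ≤ L ∧ 2 ≤ N ∧ ∀ n, N ≤ n → ∀ z z' : Torus d, IsGridPoint n z →
      IsGridPoint n z' → g n z ≤ ENNReal.ofReal (L * dist z z') + g n z' := by
  obtain ⟨-, C, hC0, hC⟩ := normM_bounds 𝓜 hcont hpd V₀
  obtain ⟨B, hB⟩ := basis_coeff (d := d) V₀
  obtain ⟨N, hN⟩ := exists_nat_gt (B * |V₀| / r₀)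
  refine ⟨d * (B * C), max N 2, by positivity, le_max_right _ _, fun n hn => ?_⟩
  have hn2 : 2 ≤ n := (le_max_right _ _).trans hn
  have hnN : N ≤ n := (le_max_left _ _).trans hn
  have hn0 : (0:ℝ) < n := by positivity
  have hs := hg n hn2
  have hBn : (n:ℝ)⁻¹ * (B * |V₀|) ≤ r₀ := by
    rw [inv_mul_le_iff₀ hn0, ← div_le_iff₀ hr₀]
    exact hN.le.trans (by exact_mod_cast hnN)
  set K : ℝ≥0∞ := ENNReal.ofReal ((n:ℝ)⁻¹ * C) with hK
  -- one unit step
  have hunit : ∀ z : Torus d, IsGridPoint n z → ∀ j : Fin d, ∀ s : ℤ, (s = 1 ∨ s = -1) →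
      g n z ≤ B * K + g n (z + s • toTorus ((n:ℝ)⁻¹ • (Pi.single j 1 : Fin d → ℝ))) := by
    intro z hz j s hsgn
    obtain ⟨u, hui, hudet, huv⟩ := hcons z
    have huV : ∀ i, euclNorm (u i) ≤ |V₀| := by
      intro i
      obtain ⟨T, hT, hiT⟩ := (huv 0 (by simpa [euclNorm] using hr₀.le) i).1
      exact (hV₀ _ T hT _ hiT).trans (le_abs_self _)
    have huV' : ∀ i, ‖u i‖ ≤ V₀ := by
      intro i
      obtain ⟨T, hT, hiT⟩ := (huv 0 (by simpa [euclNorm] using hr₀.le) i).1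
      exact (norm_le_euclNorm _).trans (hV₀ _ T hT _ hiT)
    have hu0 : ∀ i, u i ≠ 0 := by
      intro i hi
      have : (Matrix.of u).det = 0 := Matrix.det_eq_zero_of_row_eq_zero i (fun k => by simp [hi])
      rw [this] at hudet; simp at hudet
    obtain ⟨c, hcB, hc⟩ := hB u hui hudet huV' j
    set E : Fin d → Torus d := fun i => toTorus ((n:ℝ)⁻¹ • u i) with hE
    have hEg : ∀ i, IsGridPoint n (E i) := fun i => isGridPoint_toTorus n _ (hui i)
    have hsumE : ∀ c : Fin d → ℤ, ∑ i, c i • E i = toTorus ((n:ℝ)⁻¹ • ∑ i, (c i : ℝ) • u i) := by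
      intro c
      rw [hE, toTorus_sum_zsmul, Finset.smul_sum]
      congr 1
      refine Finset.sum_congr rfl fun i _ => ?_
      rw [smul_comm]
    have hstep : ∀ c : Fin d → ℤ, ∑ i, (c i).natAbs < B → ∀ i,
        g n (z + ∑ j, c j • E j) ≤ K + g n (z + ∑ j, c j • E j + E i) ∧
        g n (z + ∑ j, c j • E j) ≤ K + g n (z + ∑ j, c j • E j - E i) := by
      intro c hc i
      have hgrid : IsGridPoint n (z + ∑ j, c j • E j) :=
        hz.add (isGridPoint_sum _ fun i => (hEg i).zsmul _)
      have hw : euclNorm ((n:ℝ)⁻¹ • ∑ i, (c i : ℝ) • u i) ≤ r₀ := by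
        refine le_trans ?_ hBn
        rw [euclNorm_smul, abs_of_nonneg (by positivity)]
        gcongr
        refine (euclNorm_sum_le _ _).trans ?_
        have : ∀ i ∈ Finset.univ, euclNorm ((c i : ℝ) • u i) ≤ ((c i).natAbs : ℝ) * |V₀| := by
          intro i _
          rw [euclNorm_smul, Nat.cast_natAbs, Int.cast_abs]
          gcongr
          exact huV i
        refine (Finset.sum_le_sum this).trans ?_
        rw [← Finset.sum_mul]
        gcongr
        exact_mod_cast hc.le
      have hver := huv _ hw i
      rw [← hsumE] at hver
      have hcost : ∀ v : Fin d → ℝ, ‖v‖ ≤ V₀ → ENNReal.ofReal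
          (normM (𝓜 (z + ∑ j, c j • E j)) ((n : ℝ)⁻¹ • v)) ≤ K := by
        intro v hv
        apply ENNReal.ofReal_le_ofReal
        rw [normM_smul, abs_of_nonneg (by positivity)]
        gcongr
        exact hC _ _ hv
      constructor
      · refine (discrete_vertex hs hgrid (hu0 i) hver.1).trans ?_
        gcongr
        exact hcost _ (huV' i)
      · refine (discrete_vertex hs hgrid (neg_ne_zero.2 (hu0 i)) hver.2).trans ?_
        gcongr
        · exact hcost _ (by simpa using huV' i)
        · rw [smul_neg, toTorus_neg, ← sub_eq_add_neg]
    have hmain : ∀ c : Fin d → ℤ, ∑ i, (c i).natAbs ≤ B →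
        g n z ≤ B * K + g n (z + ∑ j, c j • E j) := by
      intro c hc
      refine (walk (g n) E z K B hstep _ hc c rfl).trans ?_
      gcongr
    rcases hsgn with rfl | rfl
    · have := hmain c hcB
      rw [hsumE, hc] at this
      simpa using this
    · have := hmain (-c) (by simpa using hcB)
      rw [hsumE] at this
      simp only [Pi.neg_apply, Int.cast_neg, neg_smul, Finset.sum_neg_distrib, hc, smul_neg] at this
      simpa [toTorus_neg] using this
  intro z z' hz hz'
  obtain ⟨k, hk, hk'⟩ := grid_lift (by omega) (hz'.sub hz)
  set E : Fin d → Torus d := fun i => toTorus ((n:ℝ)⁻¹ • (Pi.single i 1 : Fin d → ℝ)) with hE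
  have hEg : ∀ i, IsGridPoint n (E i) := fun i => isGridPoint_toTorus n _ (fun l => by
    by_cases h : l = i
    · subst h; exact ⟨1, by simp⟩
    · exact ⟨0, by simp [h]⟩)
  have hsum : ∑ i, k i • E i = z' - z := by
    rw [hk, hE, toTorus_sum_zsmul]
    congr 1
    funext l
    simp [Finset.sum_apply, Pi.single_apply, mul_comm]
  have hw := walk (g n) E z (B * K) (∑ i, (k i).natAbs) (by
    intro c _ i
    have hgrid : IsGridPoint n (z + ∑ j, c j • E j) :=
        hz.add (isGridPoint_sum _ fun i => (hEg i).zsmul _)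
    constructor
    · simpa using hunit _ hgrid i 1 (Or.inl rfl)
    · simpa [sub_eq_add_neg] using hunit _ hgrid i (-1) (Or.inr rfl)) _ le_rfl k rfl
  rw [hsum, add_sub_cancel] at hw
  refine hw.trans ?_
  gcongr
  have hBK : ((∑ i, (k i).natAbs : ℕ) : ℝ≥0∞) * (B * K)
      = ENNReal.ofReal (((∑ i, (k i).natAbs : ℕ) : ℝ) * (B * ((n:ℝ)⁻¹ * C))) := by
    rw [ENNReal.ofReal_mul (by positivity), ENNReal.ofReal_mul (by positivity),
      ENNReal.ofReal_natCast, ENNReal.ofReal_natCast]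
  rw [hBK]
  apply ENNReal.ofReal_le_ofReal
  have h1 : ((∑ i, (k i).natAbs : ℕ) : ℝ) ≤ d * (n * dist z z') := by
    push_cast
    have : ∀ i ∈ Finset.univ, (((k i).natAbs : ℕ) : ℝ) ≤ n * dist z z' := by
      intro i _
      rw [Nat.cast_natAbs, Int.cast_abs, dist_comm, dist_eq_norm]
      exact (hk' i).1
    refine (Finset.sum_le_card_nsmul _ _ _ this).trans ?_
    simp
  calc _ ≤ (d * (n * dist z z')) * (B * ((n:ℝ)⁻¹ * C)) := by gcongr
    _ = _ := by field_simp

/-! ### Real-valued form of the scheme -/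

lemma hopf_eq {d : ℕ} {n : ℕ} (hn : 0 < n) {u : Torus d → ℝ≥0∞}
    (hfin : ∀ z, IsGridPoint n z → u z ≠ ⊤) {z : Torus d} (hz : IsGridPoint n z)
    (M : Matrix (Fin d) (Fin d) ℝ)
    {T : Finset (Fin d → ℝ)} (hT : ∀ v ∈ T, IsIntVec v) (α : (Fin d → ℝ) → ℝ)
    (hα : ∀ w, 0 ≤ α w) :
    ENNReal.ofReal (normM M ((n : ℝ)⁻¹ • ∑ w ∈ T, α w • w)) +
      ∑ w ∈ T, ENNReal.ofReal (α w) * u (z + toTorus ((n : ℝ)⁻¹ • w)) =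
    ENNReal.ofReal ((n:ℝ)⁻¹ * normM M (∑ w ∈ T, α w • w) +
      ∑ w ∈ T, α w * (u (z + toTorus ((n : ℝ)⁻¹ • w))).toReal) := by
  have hn' : (0:ℝ) < n := by exact_mod_cast hn
  have hnn : ∀ w ∈ T, 0 ≤ α w * (u (z + toTorus ((n : ℝ)⁻¹ • w))).toReal :=
    fun w _ => mul_nonneg (hα w) ENNReal.toReal_nonneg
  rw [ENNReal.ofReal_add (mul_nonneg (by positivity) (normM_nonneg _ _)) (Finset.sum_nonneg hnn),
    ENNReal.ofReal_sum_of_nonneg hnn, normM_smul, abs_of_nonneg (by positivity)]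
  congr 1
  refine Finset.sum_congr rfl fun w hw => ?_
  rw [ENNReal.ofReal_mul (hα w),
    ENNReal.ofReal_toReal (hfin _ (hz.add (isGridPoint_toTorus n w (hT w hw))))]

lemma discrete_real_le {d : ℕ} {𝓜 : Torus d → Matrix (Fin d) (Fin d) ℝ}
    {𝒯 : Torus d → Finset (Finset (Fin d → ℝ))} (h𝒯 : ∀ z, IsReducedMesh (𝓜 z) (𝒯 z))
    {n : ℕ} (hn : 0 < n) {u : Torus d → ℝ≥0∞}
    (hs : SolvesDiscrete 𝓜 𝒯 n u) (hfin : ∀ z, IsGridPoint n z → u z ≠ ⊤)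
    {z : Torus d} (hz : IsGridPoint n z) (hz0 : z ≠ 0)
    {T : Finset (Fin d → ℝ)} (hT : T ∈ 𝒯 z) (β : (Fin d → ℝ) → ℝ) (hβ : ∀ w, 0 ≤ β w)
    (hβ0 : β 0 = 0) :
    (∑ w ∈ T, β w) * (u z).toReal ≤ (n:ℝ)⁻¹ * normM (𝓜 z) (∑ w ∈ T, β w • w) +
      ∑ w ∈ T, β w * (u (z + toTorus ((n : ℝ)⁻¹ • w))).toReal := by
  have hnn : 0 ≤ (n:ℝ)⁻¹ * normM (𝓜 z) (∑ w ∈ T, β w • w) +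
      ∑ w ∈ T, β w * (u (z + toTorus ((n : ℝ)⁻¹ • w))).toReal :=
    add_nonneg (mul_nonneg (by positivity) (normM_nonneg _ _))
      (Finset.sum_nonneg fun w _ => mul_nonneg (hβ w) ENNReal.toReal_nonneg)
  rcases (Finset.sum_nonneg fun w (_ : w ∈ T) => hβ w).eq_or_lt with h0 | hpos
  · rw [← h0, zero_mul]; exact hnn
  set t := ∑ w ∈ T, β w with ht
  have h := discrete_le hs hz hz0 hT (fun w => t⁻¹ * β w)
    (fun w => mul_nonneg (by positivity) (hβ w)) (by simp [hβ0])
    (by rw [← Finset.mul_sum, ← ht, inv_mul_cancel₀ hpos.ne'])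
  rw [hopf_eq hn hfin hz (𝓜 z) ((h𝒯 z).2.2.1 T hT) _
    (fun w => mul_nonneg (by positivity) (hβ w))] at h
  have e1 : ∑ w ∈ T, (t⁻¹ * β w) • w = t⁻¹ • ∑ w ∈ T, β w • w := by
    rw [Finset.smul_sum]; exact Finset.sum_congr rfl fun w _ => by rw [mul_smul]
  have e2 : ∑ w ∈ T, t⁻¹ * β w * (u (z + toTorus ((n : ℝ)⁻¹ • w))).toReal
      = t⁻¹ * ∑ w ∈ T, β w * (u (z + toTorus ((n : ℝ)⁻¹ • w))).toReal := by
    rw [Finset.mul_sum]; exact Finset.sum_congr rfl fun w _ => by rw [mul_assoc]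
  rw [e1, e2, normM_smul, abs_of_nonneg (by positivity), mul_left_comm, ← mul_add] at h
  have h' := ENNReal.toReal_le_of_le_ofReal (mul_nonneg (by positivity) hnn) h
  rwa [le_inv_mul_iff₀ hpos] at h'

lemma discrete_real_ex {d : ℕ} {𝓜 : Torus d → Matrix (Fin d) (Fin d) ℝ}
    {𝒯 : Torus d → Finset (Finset (Fin d → ℝ))} (h𝒯 : ∀ z, IsReducedMesh (𝓜 z) (𝒯 z))
    {n : ℕ} (hn : 0 < n) {u : Torus d → ℝ≥0∞}
    (hs : SolvesDiscrete 𝓜 𝒯 n u) (hfin : ∀ z, IsGridPoint n z → u z ≠ ⊤)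
    {z : Torus d} (hz : IsGridPoint n z) (hz0 : z ≠ 0) (η : ℝ) (hη : 0 < η) :
    ∃ T ∈ 𝒯 z, ∃ α : (Fin d → ℝ) → ℝ, (∀ w, 0 ≤ α w) ∧ α 0 = 0 ∧ ∑ w ∈ T, α w = 1 ∧
      (n:ℝ)⁻¹ * normM (𝓜 z) (∑ w ∈ T, α w • w) +
      ∑ w ∈ T, α w * (u (z + toTorus ((n : ℝ)⁻¹ • w))).toReal ≤ (u z).toReal + η := by
  have hlt : hopfLax (𝓜 z) (𝒯 z) n u z < u z + ENNReal.ofReal η := by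
    rw [← hs.2 z hz hz0]
    exact ENNReal.lt_add_right (hfin z hz) (by simpa using hη)
  simp only [hopfLax, iInf_lt_iff] at hlt
  obtain ⟨T, hT, α, hα, hα0, hα1, h⟩ := hlt
  refine ⟨T, hT, α, hα, hα0, hα1, ?_⟩
  rw [hopf_eq hn hfin hz (𝓜 z) ((h𝒯 z).2.2.1 T hT) _ hα, ← ENNReal.ofReal_toReal (hfin z hz),
    ← ENNReal.ofReal_add ENNReal.toReal_nonneg hη.le] at h
  exact ((ENNReal.ofReal_lt_ofReal_iff_of_nonneg (add_nonneg (mul_nonneg (by positivity)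
    (normM_nonneg _ _)) (Finset.sum_nonneg fun w _ => mul_nonneg (hα w)
      ENNReal.toReal_nonneg))).1 h).le

lemma mesh_decomp {d : ℕ} {M : Matrix (Fin d) (Fin d) ℝ}
    {𝒯 : Finset (Finset (Fin d → ℝ))} (h𝒯 : IsReducedMesh M 𝒯) (p : Fin d → ℝ) :
    ∃ T ∈ 𝒯, ∃ β : (Fin d → ℝ) → ℝ, (∀ w, 0 ≤ β w) ∧ β 0 = 0 ∧ ∑ w ∈ T, β w • w = p := by
  have hnh := h𝒯.2.1
  have ht : Filter.Tendsto (fun s : ℝ => s • p) (nhdsWithin 0 (Set.Ioi 0)) (nhds 0) := by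
    have : Continuous (fun s : ℝ => s • p) := by fun_prop
    have h := this.tendsto 0
    rw [zero_smul] at h
    exact h.mono_left nhdsWithin_le_nhds
  obtain ⟨s, hs, hs0⟩ := ((ht.eventually hnh).and self_mem_nhdsWithin).exists
  have hs0 : 0 < s := hs0
  obtain ⟨T, hT, hsT⟩ := Set.mem_iUnion₂.1 hs
  rw [Finset.mem_convexHull'] at hsT
  obtain ⟨c, hc, -, hcs⟩ := hsT
  refine ⟨T, hT, fun w => if w ∈ T ∧ w ≠ 0 then s⁻¹ * c w else 0, ?_, by simp, ?_⟩
  · intro w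
    dsimp only
    split_ifs with h
    · exact mul_nonneg (by positivity) (hc w h.1)
    · exact le_rfl
  · have : ∀ w ∈ T, (if w ∈ T ∧ w ≠ 0 then s⁻¹ * c w else 0) • w = s⁻¹ • c w • w := by
      intro w hw
      by_cases h : w = 0
      · simp [h]
      · simp [h, hw, mul_smul]
    rw [Finset.sum_congr rfl this, ← Finset.smul_sum, hcs, inv_smul_smul₀ hs0.ne']

/-! ### Convergence of discrete maximizers -/

lemma grid_near {d : ℕ} {n : ℕ} (hn : 0 < n) (z : Torus d) :
    ∃ y, IsGridPoint n y ∧ dist y z ≤ (n:ℝ)⁻¹ := by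
  obtain ⟨r, hr, -⟩ := exists_lift z
  have hn' : (0:ℝ) < n := by exact_mod_cast hn
  refine ⟨toTorus ((n:ℝ)⁻¹ • fun i => ((⌊n * r i⌋ : ℤ) : ℝ)),
    isGridPoint_toTorus n _ (fun i => ⟨_, rfl⟩), ?_⟩
  rw [← hr, dist_pi_le_iff (by positivity)]
  intro i
  simp only [toTorus, Pi.smul_apply, smul_eq_mul]
  rw [dist_eq_norm, ← AddCircle.coe_sub]
  refine (QuotientAddGroup.norm_mk_le_norm).trans ?_
  rw [Real.norm_eq_abs]
  have h1 := Int.floor_le (n * r i)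
  have h2 := Int.lt_floor_add_one (n * r i)
  have : (n:ℝ)⁻¹ * (⌊n * r i⌋ : ℝ) - r i = (n:ℝ)⁻¹ * ((⌊n * r i⌋ : ℝ) - n * r i) := by
    field_simp
  rw [this, abs_mul, abs_of_nonneg (by positivity)]
  refine mul_le_of_le_one_right (by positivity) ?_
  rw [abs_le]; constructor <;> linarith

lemma grid_max {d : ℕ} (N : ℕ → ℕ) (hN : Filter.Tendsto N Filter.atTop Filter.atTop)
    (hN0 : ∀ j, 0 < N j) (H : ℕ → Torus d → ℝ) (Hl : Torus d → ℝ) (hHl : Continuous Hl)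
    (hconv : ∀ ε > 0, ∀ᶠ j in Filter.atTop, ∀ x, |H j x - Hl x| ≤ ε)
    (z : Torus d) (hz : ∀ x, x ≠ z → Hl x < Hl z) :
    ∃ x : ℕ → Torus d, Filter.Tendsto x Filter.atTop (nhds z) ∧
      ∀ j, IsGridPoint (N j) (x j) ∧ ∀ y, IsGridPoint (N j) y → H j y ≤ H j (x j) := by
  have : Fact ((0:ℝ) < 1) := ⟨one_pos⟩
  have hmax : ∀ j, ∃ x, IsGridPoint (N j) x ∧ ∀ y, IsGridPoint (N j) y → H j y ≤ H j x := by
    intro j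
    obtain ⟨x, hx, hx'⟩ := Set.exists_max_image _ (H j) (grid_finite (d := d) (hN0 j))
      ⟨0, isGridPoint_zero _⟩
    exact ⟨x, hx, hx'⟩
  choose x hx hx' using hmax
  refine ⟨x, ?_, fun j => ⟨hx j, hx' j⟩⟩
  rw [tendsto_nhds]
  intro O hO hzO
  rcases (Oᶜ).eq_empty_or_nonempty with he | hne
  · rw [Set.compl_empty_iff] at he
    simp [he]
  obtain ⟨y, hy, hymax⟩ := (hO.isClosed_compl.isCompact).exists_isMaxOn hne hHl.continuousOn
  have hyz : Hl y < Hl z := hz y (by rintro rfl; exact hy hzO)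
  set δ := Hl z - Hl y with hδ
  have hδ0 : 0 < δ := sub_pos.2 hyz
  obtain ⟨ρ, hρ, hρ'⟩ := Metric.continuous_iff.1 hHl z (δ / 4) (by positivity)
  obtain ⟨m, hm⟩ := exists_nat_gt (ρ⁻¹)
  filter_upwards [hconv (δ / 4) (by positivity), hN.eventually_ge_atTop m] with j hj hjm
  by_contra hxO
  have h1 : Hl (x j) ≤ Hl y := hymax hxO
  obtain ⟨w, hw, hwz⟩ := grid_near (hN0 j) z
  have h2 : dist w z < ρ := by
    refine hwz.trans_lt ?_
    rw [inv_lt_comm₀ (by exact_mod_cast hN0 j) hρ]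
    exact hm.trans_le (by exact_mod_cast hjm)
  have h3 := hρ' w h2
  rw [Real.dist_eq, abs_lt] at h3
  have h4 := hx' j w hw
  have h5 := abs_le.1 (hj w)
  have h6 := abs_le.1 (hj (x j))
  linarith [h3.1, h5.1, h6.2]

/-- Descent of a periodic function to the torus. -/
lemma exists_descend {d : ℕ} (Φ : (Fin d → ℝ) → ℝ) (hΦ : Continuous Φ)
    (hper : ∀ x : Fin d → ℝ, ∀ m : Fin d → ℤ, Φ (x + fun i => (m i : ℝ)) = Φ x) :
    ∃ φ : Torus d → ℝ, Continuous φ ∧ ∀ x, φ (toTorus x) = Φ x := by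
  choose r hr hr' using exists_lift (d := d)
  have key : ∀ x, Φ (r (toTorus x)) = Φ x := by
    intro x
    have h : ∀ i, ∃ m : ℤ, r (toTorus x) i = x i + m := by
      intro i
      have := congrFun (hr (toTorus x)) i
      simp only [toTorus] at this
      rw [← sub_eq_zero, ← AddCircle.coe_sub, AddCircle.coe_eq_zero_iff] at this
      obtain ⟨m, hm⟩ := this
      refine ⟨m, ?_⟩
      simp at hm
      linarith
    choose m hm using h
    have : r (toTorus x) = x + fun i => (m i : ℝ) := funext hm
    rw [this, hper]
  refine ⟨fun w => Φ (r w), ?_, key⟩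
  rw [Metric.continuous_iff]
  intro w ε hε
  obtain ⟨δ, hδ, h⟩ := Metric.continuous_iff.1 hΦ (r w) ε hε
  refine ⟨δ, hδ, fun w' hw' => ?_⟩
  have e : w' = toTorus (r w + r (w' - w)) := by
    rw [toTorus_add, hr, hr]; abel
  have : Φ (r w') = Φ (r w + r (w' - w)) := by
    conv_lhs => rw [e]
    rw [key]
  show dist (Φ (r w')) (Φ (r w)) < ε
  rw [this]
  apply h
  rw [dist_eq_norm, add_sub_cancel_left]
  rw [dist_eq_norm] at hw'
  exact (hr' _).trans_lt hw'

lemma taylor {d : ℕ} (Φ : (Fin d → ℝ) → ℝ) (hΦ : ContDiff ℝ 1 Φ) (Z : Fin d → ℝ)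
    (N : ℕ → ℕ) (hN : Filter.Tendsto N Filter.atTop Filter.atTop) (hN0 : ∀ j, 0 < N j)
    (X : ℕ → Fin d → ℝ) (hX : Filter.Tendsto X Filter.atTop (nhds Z)) (V₀ : ℝ) (ε : ℝ)
    (hε : 0 < ε) :
    ∀ᶠ j in Filter.atTop, ∀ w : Fin d → ℝ, ‖w‖ ≤ V₀ →
      |(N j : ℝ) * (Φ (X j + (N j : ℝ)⁻¹ • w) - Φ (X j)) - fderiv ℝ Φ Z w| ≤ ε := by
  have hstrict : HasStrictFDerivAt Φ (fderiv ℝ Φ Z) Z :=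
    hΦ.contDiffAt.hasStrictFDerivAt (by simp)
  have hc : 0 < ε / (|V₀| + 1) := by positivity
  have h := hstrict.isLittleO.bound hc
  obtain ⟨δ, hδ, hball⟩ := Metric.eventually_nhds_iff.1 h
  obtain ⟨m, hm⟩ := exists_nat_gt ((|V₀| + 1) / (δ / 2))
  have hXe : ∀ᶠ j in Filter.atTop, dist (X j) Z < δ / 2 :=
    hX.eventually (Metric.ball_mem_nhds Z (by positivity))
  filter_upwards [hXe, hN.eventually_ge_atTop m] with j hj hjm w hw
  have hn : (0:ℝ) < N j := by exact_mod_cast hN0 j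
  have hw' : ‖w‖ ≤ |V₀| := hw.trans (le_abs_self _)
  have hsmall : ‖(N j : ℝ)⁻¹ • w‖ < δ / 2 := by
    rw [norm_smul, norm_inv, Real.norm_of_nonneg hn.le, inv_mul_lt_iff₀ hn, ← div_lt_iff₀ (by positivity)]
    have : (m:ℝ) ≤ N j := by exact_mod_cast hjm
    refine lt_of_le_of_lt ?_ (hm.trans_le this)
    gcongr
    linarith
  have hb := hball (y := (X j + (N j : ℝ)⁻¹ • w, X j)) (by
    rw [Prod.dist_eq, max_lt_iff]
    refine ⟨?_, hj.trans (by linarith)⟩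
    calc dist (X j + (N j : ℝ)⁻¹ • w) Z ≤ dist (X j + (N j : ℝ)⁻¹ • w) (X j) + dist (X j) Z :=
          dist_triangle _ _ _
      _ < δ / 2 + δ / 2 := by
          refine add_lt_add ?_ hj
          rwa [dist_eq_norm, add_sub_cancel_left]
      _ = δ := by ring)
  simp only [add_sub_cancel_left, map_smul, smul_eq_mul, norm_smul, norm_inv,
    Real.norm_eq_abs, abs_of_pos hn] at hb
  have e : (N j : ℝ) * (Φ (X j + (N j : ℝ)⁻¹ • w) - Φ (X j)) - fderiv ℝ Φ Z w
      = N j * (Φ (X j + (N j : ℝ)⁻¹ • w) - Φ (X j) - (N j : ℝ)⁻¹ * fderiv ℝ Φ Z w) := by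
    field_simp
  rw [e, abs_mul, abs_of_pos hn]
  calc _ ≤ (N j : ℝ) * (ε / (|V₀| + 1) * ((N j : ℝ)⁻¹ * ‖w‖)) := by gcongr
    _ = ε / (|V₀| + 1) * ‖w‖ := by field_simp
    _ ≤ ε / (|V₀| + 1) * (|V₀| + 1) := by gcongr; linarith
    _ = ε := by field_simp

/-! ### Algebra of the dual norm -/

lemma fderiv_eq_dot {d : ℕ} (L : (Fin d → ℝ) →L[ℝ] ℝ) (w : Fin d → ℝ) :
    L w = (fun i => L (Pi.single i 1)) ⬝ᵥ w := by
  conv_lhs => rw [pi_eq_sum_univ' w]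
  rw [map_sum]
  simp only [dotProduct, map_smul, smul_eq_mul]
  exact Finset.sum_congr rfl fun i _ => mul_comm _ _

lemma dual_le {d : ℕ} {M : Matrix (Fin d) (Fin d) ℝ} (hM : M.PosDef) (q : Fin d → ℝ)
    (h : 0 ≤ normM M (-(M⁻¹.mulVec q)) + q ⬝ᵥ (-(M⁻¹.mulVec q))) : normM M⁻¹ q ≤ 1 := by
  have hdet : IsUnit M.det := hM.det_pos.ne'.isUnit
  have e : M.mulVec (M⁻¹.mulVec q) = q := by
    rw [Matrix.mulVec_mulVec, Matrix.mul_nonsing_inv _ hdet, Matrix.one_mulVec]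
  have e1 : normM M (-(M⁻¹.mulVec q)) = normM M⁻¹ q := by
    rw [normM, normM, Matrix.mulVec_neg, e, neg_dotProduct_neg, dotProduct_comm]
  have hs := normM_sq hM.inv q
  rw [e1, dotProduct_neg, ← hs] at h
  have := normM_nonneg M⁻¹ q
  by_contra hcon
  push Not at hcon
  nlinarith

lemma dual_ge {d : ℕ} {M : Matrix (Fin d) (Fin d) ℝ} (hM : M.PosDef) (q w : Fin d → ℝ)
    (hw : 0 < normM M w) (h : normM M w + q ⬝ᵥ w ≤ 0) : 1 ≤ normM M⁻¹ q := by
  have hdet : IsUnit M.det := hM.det_pos.ne'.isUnit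
  have e : M.mulVec (M⁻¹.mulVec q) = q := by
    rw [Matrix.mulVec_mulVec, Matrix.mul_nonsing_inv _ hdet, Matrix.one_mulVec]
  have hsym : Mᵀ = M := by
    have := hM.isHermitian.eq
    rwa [Matrix.conjTranspose_eq_transpose_of_trivial] at this
  have e2 : (M⁻¹.mulVec q) ⬝ᵥ M.mulVec w = q ⬝ᵥ w := by
    rw [Matrix.dotProduct_mulVec, ← Matrix.mulVec_transpose, hsym, e]
  have hs := normM_sq hM.inv q
  have hm := normM_sq hM w
  set m := normM M w
  have hp := posDef_nonneg hM (m • (M⁻¹.mulVec q) + w)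
  rw [Matrix.mulVec_add, Matrix.mulVec_smul, e, add_dotProduct, dotProduct_add, dotProduct_add,
    smul_dotProduct, dotProduct_smul, smul_dotProduct, dotProduct_smul, e2,
    dotProduct_comm (M⁻¹.mulVec q) q, dotProduct_comm w q, ← hs, ← hm] at hp
  simp only [smul_eq_mul] at hp
  have hnn := normM_nonneg M⁻¹ q
  by_contra hcon
  push Not at hcon
  have h1 : m * (q ⬝ᵥ w) ≤ - m ^ 2 := by nlinarith
  have h2 : normM M⁻¹ q ^ 2 < 1 := by nlinarith
  have h3 : 0 < m ^ 2 := by positivity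
  nlinarith

/-! ### The limit is a viscosity solution -/

lemma limit_visc {d : ℕ}
    (𝓜 : Torus d → Matrix (Fin d) (Fin d) ℝ) (hcont : Continuous 𝓜)
    (hpd : ∀ z, (𝓜 z).PosDef)
    (𝒯 : Torus d → Finset (Finset (Fin d → ℝ)))
    (h𝒯 : ∀ z, IsReducedMesh (𝓜 z) (𝒯 z))
    (V₀ : ℝ)
    (hV₀ : ∀ z : Torus d, ∀ V ∈ 𝒯 z, ∀ v ∈ V, euclNorm v ≤ V₀)
    (N : ℕ → ℕ) (hN : Filter.Tendsto N Filter.atTop Filter.atTop) (hN0 : ∀ j, 0 < N j)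
    (u : ℕ → Torus d → ℝ≥0∞) (hu : ∀ j, SolvesDiscrete 𝓜 𝒯 (N j) (u j))
    (hfin : ∀ j z, IsGridPoint (N j) z → u j z ≠ ⊤)
    (F : ℕ → Torus d → ℝ) (hFu : ∀ j z, IsGridPoint (N j) z → F j z = (u j z).toReal)
    (Fl : Torus d → ℝ) (hFl : Continuous Fl) (hFl0 : Fl 0 = 0) (hFlnn : ∀ z, 0 ≤ Fl z)
    (hconv : ∀ ε > 0, ∀ᶠ j in Filter.atTop, ∀ x, |F j x - Fl x| ≤ ε) :
    IsViscositySol 𝓜 Fl := by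
  refine ⟨hFl, hFlnn, hFl0, ?_⟩
  intro Φ hΦ hper Z hZ
  obtain ⟨φ, hφ, hφΦ⟩ := exists_descend Φ hΦ.continuous hper
  obtain ⟨⟨lam, hlam, hlow⟩, -⟩ := normM_bounds 𝓜 hcont hpd V₀
  have hlowT : ∀ z, ∀ T ∈ 𝒯 z, ∀ v ∈ T, v ≠ 0 → lam ≤ normM (𝓜 z) v := by
    intro z T hT v hv hv0
    exact hlow z v (isIntVec_norm ((h𝒯 z).2.2.1 T hT v hv) hv0)
      ((norm_le_euclNorm v).trans (hV₀ z T hT v hv))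
  have hVT : ∀ z, ∀ T ∈ 𝒯 z, ∀ v ∈ T, ‖v‖ ≤ V₀ := fun z T hT v hv =>
    (norm_le_euclNorm v).trans (hV₀ z T hT v hv)
  have hnormc := continuous_normM 𝓜 hcont
  set L := fderiv ℝ Φ Z with hL
  set q : Fin d → ℝ := fun i => L (Pi.single i 1) with hq
  -- lifting of sequences converging to `toTorus Z`
  have hlift : ∀ x : ℕ → Torus d, Filter.Tendsto x Filter.atTop (nhds (toTorus Z)) →
      ∃ X : ℕ → Fin d → ℝ, Filter.Tendsto X Filter.atTop (nhds Z) ∧ ∀ j, toTorus (X j) = x j := by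
    intro x hx
    choose r hr hr' using exists_lift (d := d)
    refine ⟨fun j => Z + r (x j - toTorus Z), ?_, fun j => ?_⟩
    · have h0 : Filter.Tendsto (fun j => r (x j - toTorus Z)) Filter.atTop (nhds 0) := by
        apply squeeze_zero_norm (fun j => hr' _)
        rw [← tendsto_zero_iff_norm_tendsto_zero]
        simpa using hx.sub_const (toTorus Z)
      simpa using h0.const_add Z
    · rw [toTorus_add, hr]; abel
  have hconv' : ∀ ε > 0, ∀ᶠ j in Filter.atTop, ∀ x, |(F j x - φ x) - (Fl x - φ x)| ≤ ε := by
    intro ε hε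
    filter_upwards [hconv ε hε] with j hj x
    simpa using hj x
  -- comparison of sums
  have hsumT : ∀ (j : ℕ) (X : Fin d → ℝ) (ε : ℝ) (T : Finset (Fin d → ℝ)) (β : (Fin d → ℝ) → ℝ),
      (∀ w, 0 ≤ β w) → (∀ w ∈ T, ‖w‖ ≤ V₀) → (∀ w : Fin d → ℝ, ‖w‖ ≤ V₀ →
      |(N j : ℝ) * (Φ (X + (N j : ℝ)⁻¹ • w) - Φ X) - L w| ≤ ε) →
      |(N j : ℝ) * ∑ w ∈ T, β w * (Φ (X + (N j : ℝ)⁻¹ • w) - Φ X) - L (∑ w ∈ T, β w • w)|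
        ≤ ε * ∑ w ∈ T, β w := by
    intro j X ε T β hβ hT hε
    have e : (N j : ℝ) * ∑ w ∈ T, β w * (Φ (X + (N j : ℝ)⁻¹ • w) - Φ X) - L (∑ w ∈ T, β w • w)
        = ∑ w ∈ T, β w * ((N j : ℝ) * (Φ (X + (N j : ℝ)⁻¹ • w) - Φ X) - L w) := by
      rw [map_sum, Finset.mul_sum, ← Finset.sum_sub_distrib]
      refine Finset.sum_congr rfl fun w _ => ?_
      rw [map_smul, smul_eq_mul]; ring
    rw [e, Finset.mul_sum]
    refine (Finset.abs_sum_le_sum_abs _ _).trans (Finset.sum_le_sum fun w hw => ?_)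
    rw [abs_mul, abs_of_nonneg (hβ w), mul_comm]
    exact mul_le_mul_of_nonneg_right (hε w (hT w hw)) (hβ w)
  constructor
  · intro hmax
    obtain ⟨x, hx, hxmax⟩ := grid_max N hN hN0 (fun j x => F j x - φ x) (fun x => Fl x - φ x)
      (hFl.sub hφ) hconv' (toTorus Z) (by
        intro y hy
        obtain ⟨Y, rfl, -⟩ := exists_lift y
        simpa only [hφΦ] using hmax Y hy)
    obtain ⟨X, hX, hXx⟩ := hlift x hx
    apply dual_le (hpd _)
    rw [← fderiv_eq_dot]
    set p := -((𝓜 (toTorus Z))⁻¹.mulVec q) with hp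
    have hnp : Filter.Tendsto (fun j => normM (𝓜 (x j)) p) Filter.atTop
        (nhds (normM (𝓜 (toTorus Z)) p)) :=
      (hnormc.tendsto (toTorus Z, p)).comp (hx.prodMk_nhds tendsto_const_nhds)
    have key : ∀ ε > 0, 0 ≤ normM (𝓜 (toTorus Z)) p + L p
        + ε * ((d + 1) / lam * normM (𝓜 (toTorus Z)) p) := by
      intro ε hε
      refine ge_of_tendsto ((hnp.add_const (L p)).add ((hnp.const_mul ((d + 1) / lam)).const_mul ε)) ?_
      filter_upwards [taylor Φ hΦ Z N hN hN0 X hX V₀ ε hε, hx.eventually_ne hZ] with j hj hxj0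
      have hn : (0:ℝ) < N j := by exact_mod_cast hN0 j
      obtain ⟨T, hT, β, hβ, hβ0, hβp⟩ := mesh_decomp (h𝒯 (x j)) p
      have h1 := discrete_real_le h𝒯 (hN0 j) (hu j) (hfin j) (hxmax j).1 hxj0 hT β hβ hβ0
      have h2 := acute (h𝒯 (x j)) hT lam (hlowT _ T hT) β hβ hβ0
      have h3 := hsumT j (X j) ε T β hβ (hVT _ T hT) hj
      rw [hβp] at h1 h2 h3
      have h4 : ∀ w ∈ T, β w * (u j (x j + toTorus ((N j : ℝ)⁻¹ • w))).toReal
          ≤ β w * (u j (x j)).toReal + β w * (Φ (X j + (N j : ℝ)⁻¹ • w) - Φ (X j)) := by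
        intro w hw
        rw [← mul_add]
        refine mul_le_mul_of_nonneg_left ?_ (hβ w)
        have hgr := (hxmax j).1.add (isGridPoint_toTorus (N j) w ((h𝒯 (x j)).2.2.1 T hT w hw))
        have h5 := (hxmax j).2 _ hgr
        simp only [hFu j _ hgr, hFu j _ (hxmax j).1] at h5
        have e1 : φ (x j) = Φ (X j) := by rw [← hXx, hφΦ]
        have e2 : φ (x j + toTorus ((N j : ℝ)⁻¹ • w)) = Φ (X j + (N j : ℝ)⁻¹ • w) := by
          rw [← hXx, ← toTorus_add, hφΦ]
        rw [e1, e2] at h5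
        linarith
      have h5 := Finset.sum_le_sum h4
      rw [Finset.sum_add_distrib, ← Finset.sum_mul] at h5
      set S := ∑ w ∈ T, β w * (Φ (X j + (N j : ℝ)⁻¹ • w) - Φ (X j))
      have h6 : 0 ≤ (N j : ℝ)⁻¹ * normM (𝓜 (x j)) p + S := by linarith
      have h7 : 0 ≤ normM (𝓜 (x j)) p + N j * S := by
        have := mul_nonneg hn.le h6
        rwa [mul_add, mul_inv_cancel_left₀ hn.ne'] at this
      have h8 : ε * ∑ w ∈ T, β w ≤ ε * ((d + 1) / lam * normM (𝓜 (x j)) p) := by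
        refine mul_le_mul_of_nonneg_left ?_ hε.le
        rw [div_mul_eq_mul_div, le_div_iff₀ hlam, mul_comm]
        exact h2
      have h9 := (abs_le.1 h3).2
      linarith
    by_contra hcon
    push Not at hcon
    set A := normM (𝓜 (toTorus Z)) p + L p
    set c := (d + 1) / lam * normM (𝓜 (toTorus Z)) p
    have hc : 0 ≤ c := mul_nonneg (by positivity) (normM_nonneg _ _)
    have := key (-A / (2 * (c + 1))) (div_pos (by linarith) (by positivity))
    have h2 : -A / (2 * (c + 1)) * c ≤ -A / 2 := by
      rw [div_mul_eq_mul_div, div_le_div_iff₀ (by positivity) (by positivity)]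
      nlinarith
    linarith
  · intro hmin
    obtain ⟨x, hx, hxmax⟩ := grid_max N hN hN0 (fun j x => -(F j x - φ x))
      (fun x => -(Fl x - φ x)) (hFl.sub hφ).neg (by
        intro ε hε
        filter_upwards [hconv' ε hε] with j hj y
        have := hj y
        rwa [← abs_neg, neg_sub', sub_eq_add_neg, ← sub_eq_add_neg] at this) (toTorus Z) (by
        intro y hy
        obtain ⟨Y, rfl, -⟩ := exists_lift y
        have := hmin Y hy
        simp only [hφΦ]
        linarith)
    obtain ⟨X, hX, hXx⟩ := hlift x hx
    -- near-optimal stencil points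
    obtain ⟨j0, hj0⟩ := Filter.eventually_atTop.1 (hx.eventually_ne hZ)
    have hex : ∀ j, ∃ w : Fin d → ℝ, j0 ≤ j → (‖w‖ ≤ V₀ ∧ lam ≤ (d + 1) * normM (𝓜 (x j)) w ∧
        ∀ ε : ℝ, (∀ w : Fin d → ℝ, ‖w‖ ≤ V₀ →
          |(N j : ℝ) * (Φ (X j + (N j : ℝ)⁻¹ • w) - Φ (X j)) - L w| ≤ ε) →
          normM (𝓜 (x j)) w + L w ≤ ε + (N j : ℝ)⁻¹) := by
      intro j
      by_cases hj : j0 ≤ j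
      swap
      · exact ⟨0, fun h => (hj h).elim⟩
      have hn : (0:ℝ) < N j := by exact_mod_cast hN0 j
      obtain ⟨T, hT, α, hα, hα0, hα1, h1⟩ := discrete_real_ex h𝒯 (hN0 j) (hu j) (hfin j)
        (hxmax j).1 (hj0 j hj) ((N j : ℝ)⁻¹ * (N j : ℝ)⁻¹) (by positivity)
      refine ⟨∑ w ∈ T, α w • w, fun _ => ⟨?_, ?_, ?_⟩⟩
      · refine (norm_sum_le _ _).trans ?_
        have : ∀ w ∈ T, ‖α w • w‖ ≤ α w * V₀ := by
          intro w hw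
          rw [norm_smul, Real.norm_of_nonneg (hα w)]
          exact mul_le_mul_of_nonneg_left (hVT _ T hT w hw) (hα w)
        refine (Finset.sum_le_sum this).trans ?_
        rw [← Finset.sum_mul, hα1, one_mul]
      · have := acute (h𝒯 (x j)) hT lam (hlowT _ T hT) α hα hα0
        rwa [hα1, mul_one] at this
      · intro ε hε
        have h3 := hsumT j (X j) ε T α hα (hVT _ T hT) hε
        have h4 : ∀ w ∈ T, α w * (u j (x j)).toReal
            + α w * (Φ (X j + (N j : ℝ)⁻¹ • w) - Φ (X j))
            ≤ α w * (u j (x j + toTorus ((N j : ℝ)⁻¹ • w))).toReal := by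
          intro w hw
          rw [← mul_add]
          refine mul_le_mul_of_nonneg_left ?_ (hα w)
          have hgr := (hxmax j).1.add (isGridPoint_toTorus (N j) w ((h𝒯 (x j)).2.2.1 T hT w hw))
          have h5 := (hxmax j).2 _ hgr
          simp only [hFu j _ hgr, hFu j _ (hxmax j).1] at h5
          have e1 : φ (x j) = Φ (X j) := by rw [← hXx, hφΦ]
          have e2 : φ (x j + toTorus ((N j : ℝ)⁻¹ • w)) = Φ (X j + (N j : ℝ)⁻¹ • w) := by
            rw [← hXx, ← toTorus_add, hφΦ]
          rw [e1, e2] at h5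
          linarith
        have h5 := Finset.sum_le_sum h4
        rw [Finset.sum_add_distrib, ← Finset.sum_mul, hα1, one_mul] at h5
        rw [hα1, mul_one] at h3
        set S := ∑ w ∈ T, α w * (Φ (X j + (N j : ℝ)⁻¹ • w) - Φ (X j))
        set P := ∑ w ∈ T, α w • w
        have h6 : (N j : ℝ)⁻¹ * normM (𝓜 (x j)) P + S ≤ (N j : ℝ)⁻¹ * (N j : ℝ)⁻¹ := by linarith
        have h7 : normM (𝓜 (x j)) P + N j * S ≤ (N j : ℝ)⁻¹ := by
          have := mul_le_mul_of_nonneg_left h6 hn.le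
          rwa [mul_add, mul_inv_cancel_left₀ hn.ne', mul_inv_cancel_left₀ hn.ne'] at this
        have h9 := (abs_le.1 h3).1
        linarith
    choose w hw using hex
    obtain ⟨wl, -, ψ, hψ, hwl⟩ := (isCompact_closedBall (0 : Fin d → ℝ) V₀).tendsto_subseq'
      (x := w) (Filter.Eventually.frequently (Filter.eventually_atTop.2 ⟨j0, fun j hj => by
        simpa using (hw j hj).1⟩))
    have hψt := hψ.tendsto_atTop
    have hnw : Filter.Tendsto (fun j => normM (𝓜 (x (ψ j))) (w (ψ j))) Filter.atTop
        (nhds (normM (𝓜 (toTorus Z)) wl)) :=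
      (hnormc.tendsto (toTorus Z, wl)).comp ((hx.comp hψt).prodMk_nhds hwl)
    have hLw : Filter.Tendsto (fun j => L (w (ψ j))) Filter.atTop (nhds (L wl)) :=
      (L.continuous.tendsto wl).comp hwl
    apply dual_ge (hpd _) q wl
    · have : lam ≤ (d + 1) * normM (𝓜 (toTorus Z)) wl := by
        refine ge_of_tendsto (hnw.const_mul ((d:ℝ) + 1)) ?_
        filter_upwards [hψt.eventually_ge_atTop j0] with j hj
        exact (hw _ hj).2.1
      by_contra hcon
      push Not at hcon
      have h0 : (0:ℝ) < d + 1 := by positivity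
      nlinarith
    · rw [hq, ← fderiv_eq_dot]
      apply le_of_forall_pos_le_add
      intro ε hε
      rw [zero_add]
      have hNinv : Filter.Tendsto (fun j => ε + (N (ψ j) : ℝ)⁻¹) Filter.atTop (nhds (ε + 0)) := by
        refine Filter.Tendsto.const_add ε ?_
        exact tendsto_inv_atTop_zero.comp
          (tendsto_natCast_atTop_atTop.comp (hN.comp hψt))
      rw [add_zero] at hNinv
      refine le_of_tendsto_of_tendsto (hnw.add hLw) hNinv ?_
      filter_upwards [hψt.eventually_ge_atTop j0,
        hψt.eventually (taylor Φ hΦ Z N hN hN0 X hX V₀ ε hε)] with j hj hT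
      exact (hw _ hj).2.2 ε hT

/-- Theorem `th:algo` (iii): convergence of the discrete solutions towards the (unique)
viscosity solution of the continuous anisotropic eikonal equation. -/
theorem stmt15 {d : ℕ}
    (𝓜 : Torus d → Matrix (Fin d) (Fin d) ℝ) (hcont : Continuous 𝓜)
    (hpd : ∀ z, (𝓜 z).PosDef)
    (𝒯 : Torus d → Finset (Finset (Fin d → ℝ)))
    (h𝒯 : ∀ z, IsReducedMesh (𝓜 z) (𝒯 z))
    (V₀ : ℝ)
    (hV₀ : ∀ z : Torus d, ∀ V ∈ 𝒯 z, ∀ v ∈ V, euclNorm v ≤ V₀)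
    (r₀ : ℝ) (hr₀ : 0 < r₀)
    (hcons : ∀ z : Torus d, ∃ u : Fin d → Fin d → ℝ,
      (∀ i, IsIntVec (u i)) ∧ |(Matrix.of u).det| = 1 ∧
      ∀ w : Fin d → ℝ, euclNorm w ≤ r₀ →
        ∀ i : Fin d, IsMeshVertex (𝒯 (z + toTorus w)) (u i) ∧
          IsMeshVertex (𝒯 (z + toTorus w)) (-(u i)))
    (g : ℕ → Torus d → ℝ≥0∞)
    (hg : ∀ n : ℕ, 2 ≤ n → SolvesDiscrete 𝓜 𝒯 n (g n))
    (U : Torus d → ℝ) (hU : IsViscositySol 𝓜 U)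
    (huniq : ∀ U' : Torus d → ℝ, IsViscositySol 𝓜 U' → U' = U) :
    ∀ ε : ℝ, 0 < ε → ∃ N : ℕ, ∀ n : ℕ, N ≤ n →
      ∀ z : Torus d, IsGridPoint n z →
        g n z ≠ ⊤ ∧ |U z - (g n z).toReal| < ε := by
  have : Fact ((0:ℝ) < 1) := ⟨one_pos⟩
  obtain ⟨L, N₀, hL, hN₀, hlip⟩ :=
    discrete_lip 𝓜 hcont hpd 𝒯 V₀ hV₀ r₀ hr₀ hcons g hg
  have hfin : ∀ n, N₀ ≤ n → ∀ z, IsGridPoint n z → g n z ≠ ⊤ := by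
    intro n hn z hz
    have h := hlip n hn z 0 hz (isGridPoint_zero n)
    rw [(hg n (hN₀.trans hn)).1, add_zero] at h
    exact ne_top_of_le_ne_top ENNReal.ofReal_ne_top h
  have hreal : ∀ n, N₀ ≤ n → ∀ z z', IsGridPoint n z → IsGridPoint n z' →
      (g n z).toReal ≤ (g n z').toReal + L * dist z z' := by
    intro n hn z z' hz hz'
    have h := hlip n hn z z' hz hz'
    rw [← ENNReal.ofReal_toReal (hfin n hn z' hz'),
      ← ENNReal.ofReal_add (by positivity) ENNReal.toReal_nonneg] at h
    have := ENNReal.toReal_le_of_le_ofReal (by positivity) h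
    linarith
  have hext : ∀ n, ∃ f : BoundedContinuousFunction (Torus d) ℝ, N₀ ≤ n →
      LipschitzWith ⟨L, hL⟩ f ∧ (∀ z, 0 ≤ f z) ∧
        ∀ z, IsGridPoint n z → f z = (g n z).toReal := by
    intro n
    by_cases hn : N₀ ≤ n
    swap
    · exact ⟨0, fun h => (hn h).elim⟩
    have h1 : LipschitzOnWith ⟨L, hL⟩ (fun z => (g n z).toReal) {z | IsGridPoint n z} :=
      LipschitzOnWith.of_le_add_mul _ fun z hz z' hz' => hreal n hn z z' hz hz'
    obtain ⟨f, hf, hfe⟩ := h1.extend_real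
    have hf' := hf.max_const 0
    refine ⟨BoundedContinuousFunction.mkOfCompact ⟨fun z => max (f z) 0, hf'.continuous⟩,
      fun _ => ⟨hf', fun z => le_max_right _ _, fun z hz => ?_⟩⟩
    have : f z = (g n z).toReal := (hfe hz).symm
    show max (f z) 0 = _
    rw [this, max_eq_left ENNReal.toReal_nonneg]
  choose F hF using hext
  set A : Set (BoundedContinuousFunction (Torus d) ℝ) :=
    {f | LipschitzWith ⟨L, hL⟩ f ∧ f 0 = 0} with hA
  have hcomp : IsCompact (closure A) := by
    refine BoundedContinuousFunction.arzela_ascoli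
      (Metric.closedBall (0:ℝ) (L * Metric.diam (Set.univ : Set (Torus d))))
      (isCompact_closedBall _ _) A ?_ ?_
    · intro f x hf
      have h1 := hf.1.dist_le_mul x 0
      rw [hf.2] at h1
      rw [Metric.mem_closedBall]
      refine h1.trans (mul_le_mul_of_nonneg_left ?_ hL)
      exact Metric.dist_le_diam_of_mem isCompact_univ.isBounded trivial trivial
    · exact (LipschitzWith.uniformEquicontinuous _ ⟨L, hL⟩ fun f => f.2.1).equicontinuous
  by_contra hcon
  push Not at hcon
  obtain ⟨ε, hε, hbad⟩ := hcon
  have hbad' : ∀ j : ℕ, ∃ n, N₀ + j ≤ n ∧ ∃ z, IsGridPoint n z ∧ ε ≤ |U z - F n z| := by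
    intro j
    obtain ⟨n, hn, z, hz, h⟩ := hbad (N₀ + j)
    have hn' : N₀ ≤ n := by omega
    refine ⟨n, hn, z, hz, ?_⟩
    rw [(hF n hn').2.2 z hz]
    exact h (hfin n hn' z hz)
  choose n hn z hz hzε using hbad'
  have hnN : ∀ j, N₀ ≤ n j := fun j => by have := hn j; omega
  have hmem : ∀ j, F (n j) ∈ closure A := by
    intro j
    refine subset_closure ⟨(hF _ (hnN j)).1, ?_⟩
    rw [(hF _ (hnN j)).2.2 0 (isGridPoint_zero _), (hg _ (hN₀.trans (hnN j))).1]
    rfl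
  obtain ⟨Fl, -, ψ, hψ, hFl⟩ := hcomp.tendsto_subseq hmem
  have hconv : ∀ ε > 0, ∀ᶠ j in Filter.atTop, ∀ x, |F (n (ψ j)) x - Fl x| ≤ ε := by
    intro ε hε
    filter_upwards [hFl.eventually (Metric.ball_mem_nhds Fl hε)] with j hj x
    exact (BoundedContinuousFunction.dist_coe_le_dist x).trans (le_of_lt hj)
  have hpt : ∀ x, Filter.Tendsto (fun j => F (n (ψ j)) x) Filter.atTop (nhds (Fl x)) := by
    intro x
    rw [Metric.tendsto_nhds]
    intro ε hε
    filter_upwards [hconv (ε / 2) (by positivity)] with j hj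
    exact lt_of_le_of_lt (hj x) (by linarith)
  have hntop : Filter.Tendsto n Filter.atTop Filter.atTop :=
    Filter.tendsto_atTop_mono (fun j => (by have := hn j; omega : j ≤ n j)) Filter.tendsto_id
  have hvisc : IsViscositySol 𝓜 Fl := by
    refine limit_visc 𝓜 hcont hpd 𝒯 h𝒯 V₀ hV₀ (fun j => n (ψ j)) (hntop.comp hψ.tendsto_atTop)
      (fun j => by have := hnN (ψ j); omega) (fun j => g (n (ψ j)))
      (fun j => hg _ (hN₀.trans (hnN _))) (fun j => hfin _ (hnN _))
      (fun j => F (n (ψ j))) (fun j => (hF _ (hnN _)).2.2) Fl Fl.continuous ?_ ?_ hconv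
    · refine tendsto_nhds_unique (hpt 0) ?_
      have : ∀ j, F (n (ψ j)) 0 = 0 := by
        intro j
        rw [(hF _ (hnN _)).2.2 0 (isGridPoint_zero _), (hg _ (hN₀.trans (hnN _))).1]
        rfl
      simp [this]
    · intro x
      exact ge_of_tendsto' (hpt x) fun j => (hF _ (hnN _)).2.1 x
  have hFU := huniq _ hvisc
  obtain ⟨j, hj⟩ := (hconv (ε / 2) (by positivity)).exists
  have h1 := hj (z (ψ j))
  have h2 := hzε (ψ j)
  rw [← hFU, abs_sub_comm] at h2
  linarith

end
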